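/- Let G be a non-Hamiltonian graph on n vertices, C a longest cycle with a fixed orientation, R a component of G − V(C), and v_i, v_j distinct vertices of C joined by a path with internal vertices in R, with v_i⁻v_i⁺ ∈ Ẽ(G). If l is a neighbor of v_i on the segment C[v_i, v_j⁻], then l⁻v_j⁻ ∉ Ẽ(G) and v_j⁺l⁺ ∉ Ẽ(G). -/

import Mathlib

open SimpleGraph

/-- A vertex is heavy if its degree is at least half the number of vertices. -/
def Heavy {V : Type*} [Fintype V] (G : SimpleGraph V) (v : V) : Prop :=
  Fintype.card V ≤ 2 * (G.neighborSet v).ncard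

/-- `{x,y} ∈ Ẽ(G)`: distinct vertices that are adjacent or have degree sum at least `n`. -/
def TEdge {V : Type*} [Fintype V] (G : SimpleGraph V) (x y : V) : Prop :=
  x ≠ y ∧ (G.Adj x y ∨
    Fintype.card V ≤ (G.neighborSet x).ncard + (G.neighborSet y).ncard)

/-- `a` is the center and `b,c,d` the end vertices of an induced claw `K_{1,3}`. -/
def IsClaw {V : Type*} (G : SimpleGraph V) (a b c d : V) : Prop :=
  G.Adj a b ∧ G.Adj a c ∧ G.Adj a d ∧
    ¬ G.Adj b c ∧ ¬ G.Adj b d ∧ ¬ G.Adj c d ∧ b ≠ c ∧ b ≠ d ∧ c ≠ d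

/-- Every claw has at least one heavy end vertex. -/
def OneHeavy {V : Type*} [Fintype V] (G : SimpleGraph V) : Prop :=
  ∀ a b c d, IsClaw G a b c d → Heavy G b ∨ Heavy G c ∨ Heavy G d

/-- Every claw has at least two heavy end vertices. -/
def TwoHeavy {V : Type*} [Fintype V] (G : SimpleGraph V) : Prop :=
  ∀ a b c d, IsClaw G a b c d →
    (Heavy G b ∧ Heavy G c) ∨ (Heavy G b ∧ Heavy G d) ∨ (Heavy G c ∧ Heavy G d)

/-- Every claw has two end vertices with degree sum at least `n`. -/
def ClawHeavy {V : Type*} [Fintype V] (G : SimpleGraph V) : Prop :=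
  ∀ a b c d, IsClaw G a b c d →
    Fintype.card V ≤ (G.neighborSet b).ncard + (G.neighborSet c).ncard ∨
    Fintype.card V ≤ (G.neighborSet b).ncard + (G.neighborSet d).ncard ∨
    Fintype.card V ≤ (G.neighborSet c).ncard + (G.neighborSet d).ncard

/-- `G` contains no induced claw. -/
def ClawFree {V : Type*} (G : SimpleGraph V) : Prop :=
  ∀ a b c d, ¬ IsClaw G a b c d

/-- Almost distance-hereditary: in every connected induced subgraph the distance
between two vertices exceeds their distance in `G` by at most one. -/
def AlmostDH {V : Type*} (G : SimpleGraph V) : Prop :=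
  ∀ s : Set V, (G.induce s).Connected →
    ∀ x y : s, (G.induce s).dist x y ≤ G.dist (x : V) (y : V) + 1

/-- Distance-hereditary: every connected induced subgraph preserves distances. -/
def DistHered {V : Type*} (G : SimpleGraph V) : Prop :=
  ∀ s : Set V, (G.induce s).Connected →
    ∀ x y : s, (G.induce s).dist x y = G.dist (x : V) (y : V)

/-- A cycle in `G`, encoded as an injective cyclic sequence of `m ≥ 3` pairwise
adjacent-in-order vertices. -/
def IsCycleMap {V : Type*} (G : SimpleGraph V) (m : ℕ) (f : ZMod m → V) : Prop :=
  3 ≤ m ∧ Function.Injective f ∧ ∀ i, G.Adj (f i) (f (i + 1))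

/-- A longest cycle of `G`. -/
def IsLongestCycleMap {V : Type*} (G : SimpleGraph V) (m : ℕ) (f : ZMod m → V) : Prop :=
  IsCycleMap G m f ∧ ∀ (m' : ℕ) (f' : ZMod m' → V), IsCycleMap G m' f' → m' ≤ m

/-- `R` is a connected component of the subgraph of `G` induced on `W`. -/
def IsCompOf {V : Type*} (G : SimpleGraph V) (W R : Set V) : Prop :=
  R.Nonempty ∧ R ⊆ W ∧ (G.induce R).Connected ∧
    ∀ x ∈ R, ∀ y ∈ W, G.Adj x y → y ∈ R

section Helpers

variable {V : Type*}

def PF (G : SimpleGraph V) (u v : V) (L : List V) : Prop :=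
  L.IsChain G.Adj ∧ L.head? = some u ∧ L.getLast? = some v

theorem PF.append {G : SimpleGraph V} {u v w z : V} {L M : List V} (h : PF G u v L)
    (h' : PF G w z M) (hvw : G.Adj v w) : PF G u z (L ++ M) := by
  obtain ⟨h1, h2, h3⟩ := h
  obtain ⟨h1', h2', h3'⟩ := h'
  refine ⟨?_, ?_, ?_⟩
  · rw [List.isChain_append]
    refine ⟨h1, h1', ?_⟩
    intro x hx y hy
    rw [h3] at hx; rw [h2'] at hy
    simp at hx hy
    subst hx; subst hy; exact hvw
  · simp [List.head?_append, h2]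
  · simp [List.getLast?_append, h3']

theorem PF.reverse {G : SimpleGraph V} {u v : V} {L : List V} (h : PF G u v L) :
    PF G v u L.reverse := by
  obtain ⟨h1, h2, h3⟩ := h
  refine ⟨?_, ?_, ?_⟩
  · rw [List.isChain_reverse]
    exact h1.imp (fun a b hab => hab.symm)
  · simpa using h3
  · simpa using h2

theorem PF.single (G : SimpleGraph V) (u : V) : PF G u u [u] := by
  simp [PF]

theorem PF.mono {G H : SimpleGraph V} (hGH : G ≤ H) {u v : V} {L : List V} (h : PF G u v L) :
    PF H u v L := ⟨h.1.imp (fun _ _ hab => hGH hab), h.2⟩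

theorem PF.ofGetElem {G : SimpleGraph V} {L : List V} (h : 0 < L.length)
    (hc : L.IsChain G.Adj) : PF G L[0] (L[L.length - 1]) L := by
  refine ⟨hc, ?_, ?_⟩
  · rw [List.head?_eq_getElem?]; simp [h]
  · rw [List.getLast?_eq_getElem?]; simp [h]

theorem PF.ends {G : SimpleGraph V} {u v : V} {L : List V} (h : PF G u v L) :
    ∃ h0 : 0 < L.length, u = L[0] ∧ v = L[L.length - 1] := by
  obtain ⟨h1, h2, h3⟩ := h
  have h0 : 0 < L.length := by
    rcases L with _ | _ <;> simp at h2 ⊢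
  refine ⟨h0, ?_, ?_⟩
  · rw [List.head?_eq_getElem?] at h2; simp [h0] at h2; exact h2.symm
  · rw [List.getLast?_eq_getElem?] at h3; simp [h0] at h3; exact h3.symm

def HasCyc (G : SimpleGraph V) (t : ℕ) : Prop :=
  ∃ L u v, PF G u v L ∧ L.Nodup ∧ G.Adj v u ∧ 3 ≤ L.length ∧ t ≤ L.length

theorem HasCyc.toMap {G : SimpleGraph V} {t : ℕ} (h : HasCyc G t) :
    ∃ (m' : ℕ) (f' : ZMod m' → V), IsCycleMap G m' f' ∧ t ≤ m' := by
  obtain ⟨L, u, v, hP, hnd, hvu, h3, ht⟩ := h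
  obtain ⟨h0, rfl, rfl⟩ := hP.ends
  have hne : NeZero L.length := ⟨by omega⟩
  have : Fact (1 < L.length) := ⟨by omega⟩
  refine ⟨L.length, fun i => L[i.val]'(ZMod.val_lt i), ⟨h3, ?_, ?_⟩, ht⟩
  · intro i j hij
    apply ZMod.val_injective
    exact (hnd.getElem_inj_iff).1 hij
  · intro i
    have hlt := ZMod.val_lt i
    have hv : (i + 1).val = (i.val + 1) % L.length := by
      rw [ZMod.val_add, ZMod.val_one]
    by_cases hc : i.val + 1 < L.length
    · rw [Nat.mod_eq_of_lt hc] at hv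
      simp only [hv]
      exact (List.isChain_iff_getElem.1 hP.1) i.val hc
    · have he : i.val = L.length - 1 := by omega
      have : (i.val + 1) % L.length = 0 := by
        have : i.val + 1 = L.length := by omega
        rw [this, Nat.mod_self]
      rw [this] at hv
      simp only [hv, he]
      exact hvu

theorem path_close [Fintype V] [DecidableEq V] {G : SimpleGraph V} {u v : V} {L : List V}
    (hP : PF G u v L) (hnd : L.Nodup) (h3 : 3 ≤ L.length)
    (hd : Fintype.card V ≤ (G.neighborSet u).ncard + (G.neighborSet v).ncard) :
    HasCyc G L.length := by
  classical
  by_cases hout : ∃ w, w ∉ L ∧ G.Adj u w ∧ G.Adj v w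
  · obtain ⟨w, hw, huw, hvw⟩ := hout
    refine ⟨L ++ [w], u, w, hP.append (PF.single G w) hvw, ?_, huw.symm, by simp; omega, by simp⟩
    rw [List.nodup_append]
    simp [hnd]
    intro a ha h; exact hw (h ▸ ha)
  push Not at hout
  obtain ⟨h0, hu, hv⟩ := hP.ends
  set t := L.length with ht
  have key : ∃ i, ∃ h : i + 1 < L.length, G.Adj u L[i+1] ∧ G.Adj v L[i] := by
    by_contra hno
    push Not at hno
    -- f maps W \ ... injectively
    have e1 : (G.neighborSet u).ncard = (Finset.univ.filter (fun w => G.Adj u w)).card := by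
      rw [← Set.ncard_coe_finset]; congr 1; ext; simp
    have e2 : (G.neighborSet v).ncard = (Finset.univ.filter (fun w => G.Adj v w)).card := by
      rw [← Set.ncard_coe_finset]; congr 1; ext; simp
    rw [e1, e2] at hd
    -- shift N(v) : w ∈ L => next; w ∉ L => w
    let nx : V → V := fun w => if h : L.idxOf w + 1 < L.length then L[L.idxOf w + 1] else w
    have hnx : ∀ i (h : i + 1 < L.length), nx L[i] = L[i+1] := by
      intro i h
      have : L.idxOf L[i] = i := hnd.idxOf_getElem i (by omega)
      simp only [nx, this, h, dif_pos]
    have hnx' : ∀ w, w ∉ L → nx w = w := by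
      intro w h
      have : L.idxOf w = L.length := List.idxOf_eq_length_iff.2 h
      simp [nx, this]
    have hcase : ∀ w, G.Adj v w → w ∉ L ∨ ∃ i, ∃ h : i + 1 < L.length, w = L[i] := by
      intro w hw
      by_cases hwL : w ∈ L
      · right
        obtain ⟨i, hi, rfl⟩ := List.getElem_of_mem hwL
        refine ⟨i, ?_, rfl⟩
        by_contra hcon
        have : i = L.length - 1 := by omega
        subst this
        rw [hv] at hw
        exact G.loopless.irrefl _ hw
      · exact Or.inl hwL
    have hinj : Set.InjOn nx (Finset.univ.filter (fun w => G.Adj v w) : Finset V) := by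
      intro w hw w' hw' he
      simp at hw hw'
      rcases hcase w hw with h | ⟨i, hi, rfl⟩ <;> rcases hcase w' hw' with h' | ⟨j, hj, rfl⟩
      · rwa [hnx' _ h, hnx' _ h'] at he
      · rw [hnx' _ h, hnx _ hj] at he
        exact absurd (he ▸ List.getElem_mem hj) h
      · rw [hnx' _ h', hnx _ hi] at he
        exact absurd (he ▸ List.getElem_mem hi) h'
      · rw [hnx _ hi, hnx _ hj, hnd.getElem_inj_iff] at he
        have : i = j := by omega
        subst this; rfl
    have hnu : ∀ w, G.Adj v w → nx w ≠ u ∧ ¬ G.Adj u (nx w) := by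
      intro w hw
      rcases hcase w hw with h | ⟨i, hi, rfl⟩
      · rw [hnx' _ h]
        refine ⟨?_, fun h' => hout w h h' hw⟩
        rintro rfl
        apply h; rw [hu]; exact List.getElem_mem _
      · rw [hnx _ hi]
        refine ⟨?_, fun h' => hno i hi h' hw⟩
        rw [hu]
        intro he
        rw [hnd.getElem_inj_iff] at he
        omega
    have hsub : ((Finset.univ.filter (fun w => G.Adj v w)).image nx) ⊆
        ((Finset.univ.filter (fun w => G.Adj u w))ᶜ).erase u := by
      intro z hz
      simp at hz
      obtain ⟨w, hw, rfl⟩ := hz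
      simp [hnu w hw]
    have hcard := Finset.card_le_card hsub
    rw [Finset.card_image_of_injOn hinj, Finset.card_erase_of_mem (by simp),
      Finset.card_compl] at hcard
    have : 0 < Fintype.card V := Fintype.card_pos_iff.2 ⟨u⟩
    have hle := Finset.card_le_univ (insert u (Finset.univ.filter (fun w => G.Adj u w)))
    rw [Finset.card_insert_of_notMem (by simp)] at hle
    omega
  obtain ⟨i, hi, h1, h2⟩ := key
  have hA : PF G u L[i] (L.take (i+1)) := by
    refine ⟨hP.1.take _, ?_, ?_⟩
    · rw [List.head?_take]; simp [hP.2.1]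
    · rw [List.getLast?_take]; simp [show i < L.length by omega]
  have hB : PF G L[i+1] v (L.drop (i+1)) := by
    refine ⟨hP.1.drop _, ?_, ?_⟩
    · rw [List.head?_drop]; simp [hi]
    · rw [List.getLast?_drop]; simp [hP.2.2]; omega
  have hperm : (L.take (i+1) ++ (L.drop (i+1)).reverse).Perm L := by
    conv_rhs => rw [← List.take_append_drop (i+1) L]
    exact List.Perm.append_left _ (List.reverse_perm _)
  refine ⟨_, _, _, hA.append hB.reverse h2.symm, hperm.nodup_iff.2 hnd, h1.symm, ?_, ?_⟩
  · rw [hperm.length_eq]; exact h3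
  · rw [hperm.length_eq]

theorem closing_case [Fintype V] [DecidableEq V] {G : SimpleGraph V} {x y u v : V}
    {L : List V}
    (hd : Fintype.card V ≤ (G.neighborSet x).ncard + (G.neighborSet y).ncard)
    (hP : PF (G ⊔ edge x y) u v L) (hnd : L.Nodup) (h3 : 3 ≤ L.length)
    (hH : (G ⊔ edge x y).Adj v u) (hG : ¬ G.Adj v u) : HasCyc G L.length := by
  have hvu : (v = x ∧ u = y) ∨ (v = y ∧ u = x) := by
    rw [sup_adj, edge_adj] at hH
    rcases hH with h | h
    · exact absurd h hG
    · tauto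
  obtain ⟨h0, hu, hv⟩ := hP.ends
  have hPG : PF G u v L := by
    refine ⟨?_, hP.2⟩
    rw [List.isChain_iff_getElem]
    intro i hi
    have hadj := (List.isChain_iff_getElem.1 hP.1) i hi
    rw [sup_adj, edge_adj] at hadj
    rcases hadj with h | ⟨h, -⟩
    · exact h
    · exfalso
      have : (L[i] = v ∧ L[i+1] = u) ∨ (L[i] = u ∧ L[i+1] = v) := by
        rcases hvu with ⟨rfl, rfl⟩ | ⟨rfl, rfl⟩ <;> tauto
      rw [hu, hv] at this
      simp only [hnd.getElem_inj_iff] at this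
      omega
  apply path_close hPG hnd h3
  rcases hvu with ⟨rfl, rfl⟩ | ⟨rfl, rfl⟩ <;> omega

theorem HasCyc.mono {G : SimpleGraph V} {s t : ℕ} (h : HasCyc G t) (hst : s ≤ t) : HasCyc G s := by
  obtain ⟨L, u, v, h1, h2, h3, h4, h5⟩ := h
  exact ⟨L, u, v, h1, h2, h3, h4, by omega⟩

theorem closure_edge [Fintype V] [DecidableEq V] {G : SimpleGraph V} {x y : V} {t : ℕ}
    (hT : TEdge G x y) (h : HasCyc (G ⊔ edge x y) t) : HasCyc G t := by
  obtain ⟨hne, hT⟩ := hT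
  rcases hT with hadj | hd
  · have : G ⊔ edge x y = G := by
      rw [sup_eq_left]
      intro a b hab
      rw [edge_adj] at hab
      rcases hab with ⟨⟨rfl, rfl⟩ | ⟨rfl, rfl⟩, -⟩
      · exact hadj
      · exact hadj.symm
    rwa [this] at h
  obtain ⟨L, u, v, hP, hnd, hvu, h3, ht⟩ := h
  by_cases hG : G.Adj v u
  · by_cases hc : L.IsChain G.Adj
    · exact ⟨L, u, v, ⟨hc, hP.2⟩, hnd, hG, h3, ht⟩
    · rw [List.isChain_iff_getElem] at hc
      push Not at hc
      obtain ⟨i, hi, hbad⟩ := hc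
      have hH := (List.isChain_iff_getElem.1 hP.1) i hi
      have hA : PF (G ⊔ edge x y) u L[i] (L.take (i+1)) := by
        refine ⟨hP.1.take _, ?_, ?_⟩
        · rw [List.head?_take]; simp [hP.2.1]
        · rw [List.getLast?_take]; simp [show i < L.length by omega]
      have hB : PF (G ⊔ edge x y) L[i+1] v (L.drop (i+1)) := by
        refine ⟨hP.1.drop _, ?_, ?_⟩
        · rw [List.head?_drop]; simp [hi]
        · rw [List.getLast?_drop]; simp [hP.2.2]; omega
      have hperm : (L.drop (i+1) ++ L.take (i+1)).Perm L := by
        conv_rhs => rw [← List.take_append_drop (i+1) L]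
        exact List.perm_append_comm
      have := closing_case hd (hB.append hA hvu) (hperm.nodup_iff.2 hnd)
        (by rw [hperm.length_eq]; exact h3) hH hbad
      rw [hperm.length_eq] at this
      exact this.mono ht
  · exact (closing_case hd hP hnd h3 hvu hG).mono ht

theorem TEdge.mono [Fintype V] {G H : SimpleGraph V} (hGH : G ≤ H) {x y : V} (h : TEdge G x y) :
    TEdge H x y := by
  obtain ⟨h1, h2⟩ := h
  refine ⟨h1, ?_⟩
  rcases h2 with h2 | h2
  · exact Or.inl (hGH h2)
  · right
    have := Set.ncard_le_ncard (s := G.neighborSet x) (t := H.neighborSet x)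
      (fun w hw => hGH hw) (Set.toFinite _)
    have := Set.ncard_le_ncard (s := G.neighborSet y) (t := H.neighborSet y)
      (fun w hw => hGH hw) (Set.toFinite _)
    omega

theorem closure_two [Fintype V] [DecidableEq V] {G : SimpleGraph V} {x y z w : V} {t : ℕ}
    (hT : TEdge G x y) (hT' : TEdge G z w) (h : HasCyc ((G ⊔ edge x y) ⊔ edge z w) t) :
    HasCyc G t :=
  closure_edge hT (closure_edge (hT'.mono le_sup_left) h)

/-- segment of a sequence from index i to index j -/
def sg (g : ℕ → V) (i j : ℕ) : List V := (List.range' i (j + 1 - i)).map g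

theorem sg_PF {H : SimpleGraph V} (g : ℕ → V) (hg : ∀ i, H.Adj (g i) (g (i+1))) {i j : ℕ}
    (hij : i ≤ j) : PF H (g i) (g j) (sg g i j) := by
  have h0 : 0 < (sg g i j).length := by simp [sg]; omega
  have hc : (sg g i j).IsChain H.Adj := by
    rw [List.isChain_iff_getElem]
    intro k hk
    simp only [sg, List.getElem_map, List.getElem_range', one_mul]
    exact hg _
  have := PF.ofGetElem h0 hc
  simp only [sg, List.getElem_map, List.getElem_range', one_mul, List.length_map,
    List.length_range'] at this
  have e : i + (j + 1 - i - 1) = j := by omega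
  rw [sg]
  simpa [e] using this

theorem sg_append (g : ℕ → V) {i j k : ℕ} (hij : i ≤ j + 1) (hjk : j ≤ k) :
    sg g i j ++ sg g (j+1) k = sg g i k := by
  rw [sg, sg, sg, ← List.map_append]
  congr 1
  have e : k + 1 - i = (j + 1 - i) + (k + 1 - (j + 1)) := by omega
  have e2 : j + 1 = i + (j + 1 - i) := by omega
  rw [e]
  conv_lhs => enter [2]; rw [e2]
  rw [← List.range'_append_1]
  congr 2
  omega

theorem core [Fintype V] [DecidableEq V] (G : SimpleGraph V) (m : ℕ) (g : ℕ → V)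
    (hm : 3 ≤ m) (hg : ∀ i, G.Adj (g i) (g (i+1))) (hper : g m = g 0)
    (hinj : ∀ i < m, ∀ j < m, g i = g j → i = j)
    (hmax : ¬ HasCyc G (m+1))
    (Q : List V) (q q' : V) (hQ : PF G q q' Q) (hQn : Q.Nodup) (hQd : ∀ i, g i ∉ Q)
    (s k : ℕ) (hs : 1 ≤ s) (hsk : s + 1 ≤ k) (hkm : k + 1 ≤ m)
    (hq : G.Adj (g 0) q) (hq' : G.Adj q' (g k))
    (hvi : TEdge G (g (m-1)) (g 1)) (hl : G.Adj (g s) (g 0)) :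
    ¬ TEdge G (g (s-1)) (g (k-1)) ∧ ¬ TEdge G (g (k+1)) (g (s+1)) := by
  have hfin : ∀ (H : SimpleGraph V) (M : List V) (u v : V), G ≤ H →
      PF H u v M → H.Adj q' u → H.Adj v (g 0) → M.Perm (sg g 1 (m-1)) → HasCyc H (m+1) := by
    intro H M u v hGH hM h1 h2 hperm
    have hlen : M.length = m - 1 := by rw [hperm.length_eq]; simp [sg]
    have hQl : 0 < Q.length := hQ.ends.1
    refine ⟨([g 0] ++ Q) ++ M, g 0, v, ((PF.single H _).append (hQ.mono hGH) (hGH hq)).append hM h1,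
      ?_, h2, ?_, ?_⟩
    · have hMn : M.Nodup := by
        rw [hperm.nodup_iff, sg]
        apply List.Nodup.map_on _ List.nodup_range'
        intro x hx y hy
        simp at hx hy
        exact hinj x (by omega) y (by omega)
      have hMm : ∀ x, x ∈ M → ∃ i, 1 ≤ i ∧ i < m ∧ x = g i := by
        intro x hx
        rw [hperm.mem_iff] at hx
        simp only [sg, List.mem_map, List.mem_range'_1] at hx
        obtain ⟨i, hi, rfl⟩ := hx
        exact ⟨i, by omega, by omega, rfl⟩
      rw [List.append_assoc, List.singleton_append, List.nodup_cons, List.nodup_append]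
      refine ⟨?_, hQn, hMn, ?_⟩
      · rw [List.mem_append]
        rintro (h | h)
        · exact hQd 0 h
        · obtain ⟨i, hi, him, he⟩ := hMm _ h
          have := hinj 0 (by omega) i him he
          omega
      · intro x hx y hy hxy
        obtain ⟨i, hi, him, rfl⟩ := hMm _ hy
        exact hQd i (hxy ▸ hx)
    · simp [hlen]; omega
    · simp [hlen]; omega
  have hT : ∀ x y, TEdge G x y →
      (∀ H : SimpleGraph V, G ≤ H → H.Adj (g (m-1)) (g 1) → H.Adj x y → HasCyc H (m+1)) →
      False := by
    intro x y hxy hH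
    apply hmax
    apply closure_two hvi hxy
    apply hH
    · exact le_sup_left.trans le_sup_left
    · apply Or.inl; apply Or.inr
      rw [edge_adj]; exact ⟨by simp, hvi.1⟩
    · apply Or.inr
      rw [edge_adj]; exact ⟨by simp, hxy.1⟩
  constructor
  · intro hxy
    apply hT _ _ hxy
    intro H hGH hH1 hH2
    have hgH : ∀ i, H.Adj (g i) (g (i+1)) := fun i => hGH (hg i)
    by_cases hs1 : s = 1
    · subst hs1
      refine hfin H (sg g k (m-1) ++ sg g 1 (k-1)) _ _ hGH
        ((sg_PF g hgH (by omega)).append (sg_PF g hgH (by omega)) hH1) (hGH hq') hH2.symm ?_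
      refine List.perm_append_comm.trans ?_
      have := sg_append g (i := 1) (j := k - 1) (k := m - 1) (by omega) (by omega)
      rw [Nat.sub_add_cancel (by omega)] at this
      rw [this]
    · refine hfin H ((sg g k (m-1) ++ sg g 1 (s-1)) ++ (sg g s (k-1)).reverse) _ _ hGH
        (((sg_PF g hgH (by omega)).append (sg_PF g hgH (by omega)) hH1).append
          (sg_PF g hgH (by omega)).reverse hH2) (hGH hq') (hGH hl) ?_
      have h1 := sg_append g (i := 1) (j := k - 1) (k := m - 1) (by omega) (by omega)
      have h2 := sg_append g (i := 1) (j := s - 1) (k := k - 1) (by omega) (by omega)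
      rw [Nat.sub_add_cancel (by omega)] at h1 h2
      rw [← h1, ← h2, List.append_assoc]
      refine List.perm_append_comm.trans ?_
      exact ((List.reverse_perm _).append_left _).append_right _
  · intro hxy
    by_cases hk : k + 1 = m
    · apply hmax
      refine hfin G (sg g 1 (m-1)).reverse _ _ le_rfl (sg_PF g hg (by omega)).reverse ?_
        (hg 0).symm (List.reverse_perm _)
      have : k = m - 1 := by omega
      rwa [← this]
    · apply hT _ _ hxy
      intro H hGH hH1 hH2
      have hgH : ∀ i, H.Adj (g i) (g (i+1)) := fun i => hGH (hg i)
      refine hfin H (((sg g (s+1) k).reverse ++ sg g (k+1) (m-1)) ++ sg g 1 s) _ _ hGH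
        (((sg_PF g hgH (by omega)).reverse.append (sg_PF g hgH (by omega)) hH2.symm).append
          (sg_PF g hgH (by omega)) hH1) (hGH hq') (hGH hl) ?_
      rw [← sg_append g (i := 1) (j := s) (k := m - 1) (by omega) (by omega),
        ← sg_append g (i := s + 1) (j := k) (k := m - 1) (by omega) (by omega)]
      refine List.perm_append_comm.trans ?_
      exact ((List.reverse_perm _).append_right _).append_left _

theorem list_interior {G : SimpleGraph V} {u v : V} (L : List V) (n : ℕ) (hnd : L.Nodup)
    (hch : L.IsChain G.Adj) (hl : L.length = n + 1) (hlen : 2 ≤ n)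
    (e0 : L[0] = u) (e1 : L[n] = v) : ∃ Q q q', PF G q q' Q ∧ Q.Nodup ∧ G.Adj u q ∧ G.Adj q' v ∧
      u ∉ Q ∧ v ∉ Q ∧ ∀ x ∈ Q, x ∈ L := by
  have hQ0 : 0 < ((L.drop 1).take (n - 1)).length := by simp; omega
  have hQP := PF.ofGetElem hQ0 ((hch.drop 1).take (n - 1))
  rw [List.isChain_iff_getElem] at hch
  have hmem : ∀ x ∈ (L.drop 1).take (n - 1), ∃ i, ∃ h : i < L.length, 1 ≤ i ∧ i < n ∧ x = L[i] := by
    intro x hx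
    obtain ⟨i, hi, rfl⟩ := List.getElem_of_mem hx
    simp at hi
    refine ⟨i + 1, by omega, by omega, by omega, by simp⟩
  refine ⟨_, _, _, hQP, (hnd.drop).take, ?_, ?_, ?_, ?_, ?_⟩
  · have := hch 0 (by omega)
    rw [e0] at this
    simpa using this
  · have := hch (n - 1) (by omega)
    have e : n - 1 + 1 = n := by omega
    simp only [e, e1] at this
    convert this using 1
    simp [hl]
    congr 1
    omega
  · intro h
    obtain ⟨i, hi, h1, h2, he⟩ := hmem _ h
    rw [← e0, hnd.getElem_inj_iff] at he
    omega
  · intro h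
    obtain ⟨i, hi, h1, h2, he⟩ := hmem _ h
    rw [← e1, hnd.getElem_inj_iff] at he
    omega
  · intro x hx
    obtain ⟨i, hi, h1, h2, rfl⟩ := hmem _ hx
    exact List.getElem_mem _

theorem walk_interior {G : SimpleGraph V} {u v : V} (p : G.Walk u v) (hp : p.IsPath)
    (hlen : 2 ≤ p.length) : ∃ Q q q', PF G q q' Q ∧ Q.Nodup ∧ G.Adj u q ∧ G.Adj q' v ∧
      u ∉ Q ∧ v ∉ Q ∧ ∀ x ∈ Q, x ∈ p.support :=
  list_interior p.support p.length hp.support_nodup p.isChain_adj_support p.length_support hlen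
    (by simp) (by simp)

end Helpers

/-- Lemma 3(e): assume `v_i⁻v_i⁺ ∈ Ẽ(G)` and let `l = f c` be a neighbor of
`v_i` on the segment `C[v_i, v_j⁻]`. Then `l⁻v_j⁻ ∉ Ẽ(G)` and
`v_j⁺l⁺ ∉ Ẽ(G)`. -/
theorem lemma3e {V : Type*} [Fintype V] [DecidableEq V] (G : SimpleGraph V)
    (hnh : ¬ G.IsHamiltonian)
    (m : ℕ) (f : ZMod m → V) (hC : IsLongestCycleMap G m f)
    (R : Set V) (hR : IsCompOf G (Set.range f)ᶜ R)
    (a b : ZMod m) (hab : a ≠ b)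
    (p : G.Walk (f a) (f b)) (hp : p.IsPath) (hlen : 2 ≤ p.length)
    (hint : ∀ x ∈ p.support, x ≠ f a → x ≠ f b → x ∈ R)
    (hvi : TEdge G (f (a - 1)) (f (a + 1)))
    (c : ZMod m) (hseg : (c - a).val ≤ ((b - 1) - a).val)
    (hl : G.Adj (f c) (f a)) :
    ¬ TEdge G (f (c - 1)) (f (b - 1)) ∧ ¬ TEdge G (f (b + 1)) (f (c + 1)) := by
  obtain ⟨⟨hm, hfi, hfa⟩, hmax⟩ := hC
  have hne : NeZero m := ⟨by omega⟩
  have : Fact (1 < m) := ⟨by omega⟩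
  obtain ⟨Q, q, q', hQ, hQn, hq, hq', haQ, hbQ, hQs⟩ := walk_interior p hp hlen
  set g : ℕ → V := fun i => f (a + (i : ZMod m)) with hgdef
  have hba : b - a ≠ 0 := sub_ne_zero.2 hab.symm
  have hk1 : 1 ≤ (b - a).val := Nat.one_le_iff_ne_zero.2 (by rwa [Ne, ZMod.val_eq_zero])
  have hcast : ∀ x : ZMod m, ((x.val : ℕ) : ZMod m) = x := fun x => ZMod.natCast_zmod_val x
  have hb1 : ((b - 1) - a).val = (b - a).val - 1 := by
    have : b - 1 - a = (((b - a).val - 1 : ℕ) : ZMod m) := by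
      rw [Nat.cast_sub hk1, hcast]; push_cast; ring
    rw [this, ZMod.val_natCast, Nat.mod_eq_of_lt]
    have := ZMod.val_lt (b - a)
    omega
  have hca : c - a ≠ 0 := by
    intro h
    rw [sub_eq_zero] at h
    subst h
    exact G.loopless.irrefl _ hl
  have hs1 : 1 ≤ (c - a).val := Nat.one_le_iff_ne_zero.2 (by rwa [Ne, ZMod.val_eq_zero])
  have hkm := ZMod.val_lt (b - a)
  have hgb : g (b - a).val = f b := by simp [hgdef]
  have hgc : g (c - a).val = f c := by simp [hgdef]
  have hgb1 : g ((b - a).val - 1) = f (b - 1) := by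
    simp only [hgdef]; rw [Nat.cast_sub hk1, hcast]; congr 1; push_cast; ring
  have hgc1 : g ((c - a).val - 1) = f (c - 1) := by
    simp only [hgdef]; rw [Nat.cast_sub hs1, hcast]; congr 1; push_cast; ring
  have hgb2 : g ((b - a).val + 1) = f (b + 1) := by
    simp only [hgdef]; rw [Nat.cast_add, hcast]; congr 1; push_cast; ring
  have hgc2 : g ((c - a).val + 1) = f (c + 1) := by
    simp only [hgdef]; rw [Nat.cast_add, hcast]; congr 1; push_cast; ring
  have hg0 : g 0 = f a := by simp [hgdef]
  have hg1 : g 1 = f (a + 1) := by simp [hgdef]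
  have hgm : g (m - 1) = f (a - 1) := by
    simp only [hgdef]; rw [Nat.cast_sub (by omega)]; congr 1; simp; ring
  rw [← hgb1, ← hgc1, ← hgb2, ← hgc2]
  refine core G m g hm ?_ ?_ ?_ ?_ Q q q' hQ hQn ?_ (c - a).val (b - a).val hs1 (by omega)
    (by omega) (by rwa [hg0]) (by rwa [hgb]) (by rwa [hgm, hg1]) (by rwa [hgc, hg0])
  · intro i
    have := hfa (a + i)
    simp only [hgdef]
    push_cast
    rwa [← add_assoc]
  · simp [hgdef]
  · intro i hi j hj hij
    have h1 := add_left_cancel (hfi hij)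
    have h2 := congrArg ZMod.val h1
    rwa [ZMod.val_natCast, ZMod.val_natCast, Nat.mod_eq_of_lt hi, Nat.mod_eq_of_lt hj] at h2
  · intro h
    obtain ⟨m', f', hf', hle⟩ := h.toMap
    have := hmax m' f' hf'
    omega
  · intro i hi
    have hR' := hint (g i) (hQs _ hi) (fun h => haQ (h ▸ hi)) (fun h => hbQ (h ▸ hi))
    exact hR.2.1 hR' ⟨_, rfl⟩
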